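/- arXiv:math/0403374 — 4 statements merged into one kernel-verified Lean document; each statement's English description precedes it below -/
import Mathlib

section
/- The elliptic curve over Q given by the Weierstrass equation y^2 = x^3 - 10012x + 346900 (coefficients [a1,a2,a3,a4,a6] = [0,0,0,-10012,346900]) has discriminant of absolute value 32 * 382623908456, and its group of rational points contains 7 points that are linearly independent over Z (so the curve has Mordell–Weil rank at least 7). -/
namespace WeierstrassCurve.Affine.Point

variable {F L : Type*} [Field F] [Field L] [Algebra F L] {W : WeierstrassCurve.Affine F}

/-- The function `x - θ` on affine points, with value `1` at infinity. When `θ` is a root of the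
cubic `X³ + a₂X² + a₄X + a₆`, this is the `2`-descent map, before reduction modulo squares. -/
def descent (θ : L) : W.Point → L
  | zero => 1
  | some x _ _ => algebraMap F L x - θ

@[simp]
lemma descent_zero (θ : L) : descent θ (0 : W.Point) = 1 := rfl

@[simp]
lemma descent_some (θ : L) {x y : F} (h : W.Nonsingular x y) :
    descent θ (some x y h) = algebraMap F L x - θ := rfl

lemma descent_ne_zero {θ : L} (hθ : ∀ x : F, algebraMap F L x ≠ θ) (P : W.Point) :
    descent θ P ≠ 0 := by
  rcases P with _ | ⟨x, y, h⟩
  · exact one_ne_zero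
  · exact sub_ne_zero.mpr (hθ x)

variable [DecidableEq F] {θ : L}

lemma isSquare_descent_add (h₁ : W.a₁ = 0) (h₃ : W.a₃ = 0)
    (hθ : θ ^ 3 + algebraMap F L W.a₂ * θ ^ 2 + algebraMap F L W.a₄ * θ + algebraMap F L W.a₆ = 0)
    (P Q : W.Point) : IsSquare (descent θ (P + Q) * (descent θ P * descent θ Q)) := by
  rcases P with _ | ⟨x₁, y₁, hP⟩
  · change IsSquare (descent θ (0 + Q) * (1 * descent θ Q))
    rw [zero_add, one_mul]
    exact IsSquare.mul_self _
  rcases Q with _ | ⟨x₂, y₂, hQ⟩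
  · change IsSquare (descent θ (some x₁ y₁ hP + 0) * (descent θ (some x₁ y₁ hP) * 1))
    rw [add_zero, mul_one]
    exact IsSquare.mul_self _
  by_cases hxy : x₁ = x₂ ∧ y₁ = W.negY x₂ y₂
  · rw [add_of_Y_eq hxy.1 hxy.2, descent_zero, one_mul, descent_some, descent_some, hxy.1]
    exact IsSquare.mul_self _
  · rw [add_some hxy, descent_some, descent_some, descent_some]
    have key := congrArg (Polynomial.aeval θ) (addPolynomial_slope hP.1 hQ.1 hxy)
    set ℓ := W.slope x₁ x₂ y₁ y₂
    simp only [addPolynomial_eq, Cubic.toPoly, h₁, h₃, map_neg, map_mul, map_sub, map_add, map_pow,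
      Polynomial.aeval_C, Polynomial.aeval_X] at key
    refine ⟨algebraMap F L ℓ * (θ - algebraMap F L x₁) + algebraMap F L y₁, ?_⟩
    simp only [map_one, RingHom.map_zero, map_ofNat] at key
    linear_combination -key - hθ

lemma isSquare_descent_two_nsmul (h₁ : W.a₁ = 0) (h₃ : W.a₃ = 0)
    (hθ : θ ^ 3 + algebraMap F L W.a₂ * θ ^ 2 + algebraMap F L W.a₄ * θ + algebraMap F L W.a₆ = 0)
    (hF : ∀ x : F, algebraMap F L x ≠ θ) (P : W.Point) : IsSquare (descent θ (2 • P)) := by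
  have h := (isSquare_descent_add h₁ h₃ hθ P P).div
    (IsSquare.mul_self (descent θ P))
  rwa [mul_div_cancel_right₀ _ (mul_ne_zero (descent_ne_zero hF P) (descent_ne_zero hF P)),
    ← two_nsmul] at h

lemma isSquare_descent_sum {ι : Type*} (h₁ : W.a₁ = 0) (h₃ : W.a₃ = 0)
    (hθ : θ ^ 3 + algebraMap F L W.a₂ * θ ^ 2 + algebraMap F L W.a₄ * θ + algebraMap F L W.a₆ = 0)
    (hF : ∀ x : F, algebraMap F L x ≠ θ) (P : ι → W.Point) (S : Finset ι) :
    IsSquare (descent θ (∑ i ∈ S, P i) * ∏ i ∈ S, descent θ (P i)) := by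
  classical
  induction S using Finset.induction_on with
  | empty => simp
  | insert i S hi ih =>
    rw [Finset.sum_insert hi, Finset.prod_insert hi]
    have h0 := descent_ne_zero hF (∑ i ∈ S, P i)
    have h := ((isSquare_descent_add h₁ h₃ hθ (P i) (∑ i ∈ S, P i)).mul ih).div
      (IsSquare.mul_self (descent θ (∑ i ∈ S, P i)))
    refine (congrArg IsSquare ?_).mpr h
    rw [eq_div_iff (mul_ne_zero h0 h0)]
    ring

/-- If a sum of points is divisible by `2`, then the product of their images under the `2`-descent
map is a square. -/
lemma isSquare_prod_descent {ι : Type*} (h₁ : W.a₁ = 0) (h₃ : W.a₃ = 0)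
    (hθ : θ ^ 3 + algebraMap F L W.a₂ * θ ^ 2 + algebraMap F L W.a₄ * θ + algebraMap F L W.a₆ = 0)
    (hF : ∀ x : F, algebraMap F L x ≠ θ) {P : ι → W.Point} {S : Finset ι} {Q : W.Point}
    (hQ : ∑ i ∈ S, P i = 2 • Q) : IsSquare (∏ i ∈ S, descent θ (P i)) := by
  have h := isSquare_descent_sum h₁ h₃ hθ hF P S
  rw [hQ] at h
  have h' := h.div (isSquare_descent_two_nsmul h₁ h₃ hθ hF Q)
  rwa [mul_div_cancel_left₀ _ (descent_ne_zero hF _)] at h'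

lemma eq_zero_of_two_nsmul_eq_zero [NeZero (2 : F)] (h₁ : W.a₁ = 0) (h₃ : W.a₃ = 0)
    (hroot : ∀ x : F, x ^ 3 + W.a₂ * x ^ 2 + W.a₄ * x + W.a₆ ≠ 0) {P : W.Point}
    (hP : 2 • P = 0) : P = 0 := by
  rcases P with _ | ⟨x, y, h⟩
  · rfl
  · exfalso
    rw [two_nsmul, add_eq_zero_iff_eq_neg, neg_some, some.injEq, negY, h₁, h₃] at hP
    have hy : y = 0 := by
      have : 2 * y = 0 := by linear_combination hP.2
      simpa [NeZero.ne] using this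
    have heq := (equation_iff _ _).mp h.1
    apply hroot x
    rw [h₁, h₃, hy] at heq
    linear_combination -heq

end WeierstrassCurve.Affine.Point

/-- A finite family in a group without `2`-torsion is linearly independent over `ℤ` as soon as no
nonempty subfamily has a sum divisible by `2`. -/
lemma linearIndependent_int_of_sum_ne_two_nsmul {A ι : Type*} [AddCommGroup A] [Fintype ι]
    {P : ι → A} (h2 : ∀ a : A, 2 • a = 0 → a = 0)
    (hP : ∀ S : Finset ι, ∀ Q : A, ∑ i ∈ S, P i = 2 • Q → S = ∅) : LinearIndependent ℤ P := by
  classical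
  have halve : ∀ g : ι → ℤ, ∑ i, g i • P i = 0 →
      ∃ g' : ι → ℤ, (∀ i, g i = 2 * g' i) ∧ ∑ i, g' i • P i = 0 := by
    intro g hg
    have hdiv : ∀ i, g i = 2 * (g i / 2) + if Odd (g i) then 1 else 0 := by
      intro i
      split_ifs with h
      · exact (Int.two_mul_ediv_two_add_one_of_odd h).symm
      · rw [add_zero, Int.two_mul_ediv_two_of_even (Int.not_odd_iff_even.mp h)]
    have hsplit : ∑ i, g i • P i
        = 2 • ∑ i, (g i / 2) • P i + ∑ i with Odd (g i), P i := by
      rw [Finset.sum_filter, Finset.smul_sum, ← Finset.sum_add_distrib]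
      refine Finset.sum_congr rfl fun i _ ↦ ?_
      conv_lhs => rw [hdiv i]
      split_ifs <;> simp [add_smul, mul_smul, ofNat_smul_eq_nsmul]
    rw [hg] at hsplit
    have hS := hP {i | Odd (g i)} (-∑ i, (g i / 2) • P i) (by
      rw [smul_neg]; exact (neg_eq_of_add_eq_zero_right hsplit.symm).symm)
    rw [hS, Finset.sum_empty, add_zero] at hsplit
    refine ⟨fun i ↦ g i / 2, fun i ↦ ?_, h2 _ hsplit.symm⟩
    have hi : ¬ Odd (g i) := by simpa using (Finset.filter_eq_empty_iff.mp hS) (Finset.mem_univ i)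
    exact (Int.two_mul_ediv_two_of_even (Int.not_odd_iff_even.mp hi)).symm
  have hpow : ∀ n : ℕ, ∀ g : ι → ℤ, ∑ i, g i • P i = 0 → ∀ i, (2 : ℤ) ^ n ∣ g i := by
    intro n
    induction n with
    | zero => simp
    | succ n ih =>
      intro g hg i
      obtain ⟨g', hg', hsum⟩ := halve g hg
      rw [hg' i, pow_succ']
      exact mul_dvd_mul_left 2 (ih g' hsum i)
  rw [Fintype.linearIndependent_iff]
  intro g hg i
  refine Int.eq_zero_of_dvd_of_natAbs_lt_natAbs (hpow (g i).natAbs g hg i) ?_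
  rw [Int.natAbs_pow]
  exact Nat.lt_two_pow_self

namespace PadicInt

variable {p : ℕ} [Fact p.Prime]

/-- Hensel's lemma for a simple root `r` modulo `p` of the cubic `X³ + AX + B`. -/
lemma exists_root_cubic {A B r : ℤ} (hr : (p : ℤ) ∣ r ^ 3 + A * r + B)
    (hr' : ¬ (p : ℤ) ∣ 3 * r ^ 2 + A) :
    ∃ θ : ℤ_[p], θ ^ 3 + A * θ + B = 0 ∧ toZMod θ = (r : ZMod p) := by
  let f : Polynomial ℤ := .X ^ 3 + .C A * .X + .C B
  have hf (z : ℤ_[p]) : f.aeval z = z ^ 3 + A * z + B := by simp [f]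
  have hf' : f.derivative.aeval (r : ℤ_[p]) = ((3 * r ^ 2 + A : ℤ) : ℤ_[p]) := by
    simp only [f, Polynomial.derivative_X_pow, eq_intCast,
      Polynomial.derivative_intCast, Polynomial.derivative_mul, Polynomial.derivative_X, map_add,
      map_mul, map_pow, map_zero, map_one, map_natCast, map_intCast, Polynomial.aeval_X]
    push_cast
    ring
  have hd : ‖f.derivative.aeval (r : ℤ_[p])‖ = 1 := by
    rw [hf']
    exact le_antisymm (norm_le_one _) (not_lt.mp fun h ↦ hr' ((norm_int_lt_one_iff_dvd _).mp h))
  obtain ⟨θ, h0, h1, -⟩ := hensels_lemma (F := f) (a := (r : ℤ_[p])) (by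
    rw [hd, one_pow, hf]
    exact_mod_cast (norm_int_lt_one_iff_dvd _).mpr hr)
  refine ⟨θ, (hf θ).symm.trans h0, ?_⟩
  rw [hd, ← not_isUnit_iff, ← mem_nonunits_iff, ← IsLocalRing.mem_maximalIdeal,
    ← ker_toZMod, RingHom.mem_ker, map_sub, map_intCast, sub_eq_zero] at h1
  exact h1

lemma isSquare_of_isSquare_coe {z : ℤ_[p]} (hz : IsSquare (z : ℚ_[p])) : IsSquare z := by
  obtain ⟨w, hw⟩ := hz
  have hw1 : ‖w‖ ≤ 1 := by
    have h : ‖w‖ * ‖w‖ ≤ 1 := by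
      rw [← norm_mul, ← hw]
      exact z.2
    nlinarith [norm_nonneg w]
  exact ⟨⟨w, hw1⟩, Subtype.ext hw⟩

end PadicInt

section IntegralPoints

open WeierstrassCurve.Affine

/-- If a sum of points of `y² = x³ + Ax + B` with integral `x`-coordinates is divisible by `2`, then
the Legendre symbols of the `x - r` multiply to `1`, for `r` a simple root of the cubic modulo `p`
with all `x - r` prime to `p`. -/
lemma prod_legendreSym_eq_one {p : ℕ} [Fact p.Prime] {W : WeierstrassCurve ℚ} {A B r : ℤ}
    (hW : W = ⟨0, 0, 0, A, B⟩) (hroot : ∀ x : ℚ, x ^ 3 + A * x + B ≠ 0)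
    (hr : (p : ℤ) ∣ r ^ 3 + A * r + B) (hr' : ¬ (p : ℤ) ∣ 3 * r ^ 2 + A)
    {ι : Type*} {S : Finset ι} {x y : ι → ℤ} (h : ∀ i, W.toAffine.Nonsingular (x i) (y i))
    (hx : ∀ i ∈ S, legendreSym p (x i - r) ≠ 0) {Q : W.toAffine.Point}
    (hQ : ∑ i ∈ S, Point.some _ _ (h i) = 2 • Q) :
    ∏ i ∈ S, legendreSym p (x i - r) = 1 := by
  obtain ⟨θ, hθ, hθr⟩ := PadicInt.exists_root_cubic hr hr'
  have hθ' : (θ : ℚ_[p]) ^ 3 + A * θ + B = 0 := by exact_mod_cast congrArg _ hθ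
  have hF : ∀ x : ℚ, algebraMap ℚ ℚ_[p] x ≠ θ := by
    intro x hx
    apply hroot x
    apply (algebraMap ℚ ℚ_[p]).injective
    simpa only [map_add, map_mul, map_pow, map_intCast, map_zero, hx] using hθ'
  have hsq := Point.isSquare_prod_descent (W := W.toAffine) (θ := (θ : ℚ_[p])) (by simp [hW])
    (by simp [hW]) (by simpa [hW] using hθ') hF hQ
  have hcoe : ∏ i ∈ S, Point.descent (θ : ℚ_[p]) (Point.some _ _ (h i))
      = ((∏ i ∈ S, ((x i : ℤ_[p]) - θ) : ℤ_[p]) : ℚ_[p]) := by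
    change _ = PadicInt.Coe.ringHom (∏ i ∈ S, ((x i : ℤ_[p]) - θ))
    rw [map_prod]
    refine Finset.prod_congr rfl fun i _ ↦ ?_
    simp only [Point.descent_some, map_intCast, map_sub]
    rfl
  rw [hcoe] at hsq
  have hmod := (PadicInt.isSquare_of_isSquare_coe hsq).map PadicInt.toZMod
  have hprod : ∏ i ∈ S, legendreSym p (x i - r) = legendreSym p (∏ i ∈ S, (x i - r)) :=
    (map_prod (legendreSym.hom p) _ _).symm
  have hne : legendreSym p (∏ i ∈ S, (x i - r)) ≠ 0 := by
    rw [← hprod]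
    exact Finset.prod_ne_zero_iff.mpr hx
  rw [hprod]
  rw [Ne, legendreSym.eq_zero_iff] at hne
  rw [legendreSym.eq_one_iff _ hne]
  simpa [hθr] using hmod

lemma cubic_ne_zero (x : ℚ) : x ^ 3 + (-10012 : ℤ) * x + (346900 : ℤ) ≠ 0 := by
  intro hx
  let f : Polynomial ℤ := .X ^ 3 + .C (-10012) * .X + .C (346900 : ℤ)
  have hmonic : f.Monic := by unfold f; monicity!
  obtain ⟨n, rfl⟩ := isInteger_of_is_root_of_monic hmonic (r := x) (by
    simpa only [f, map_add, map_mul, map_pow, Polynomial.aeval_X, eq_intCast,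
      map_intCast] using hx)
  have hn : n ^ 3 + (-10012) * n + 346900 = 0 := by
    rw [eq_intCast] at hx
    exact_mod_cast hx
  have hmod : ∀ m : ZMod 3, m ^ 3 + (-10012) * m + 346900 ≠ 0 := by decide
  exact hmod n (by exact_mod_cast congrArg (Int.cast : ℤ → ZMod 3) hn)

end IntegralPoints

/-- The elliptic curve `[0, 0, 0, -10012, 346900]` has discriminant of absolute value `32 * 382623908456`,
and its group of rational points contains `7` points that are linearly independent
over `ℤ` (so its Mordell–Weil rank is at least `7`). -/
theorem rank7_low_conductor_curve (W : WeierstrassCurve ℚ)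
    (hW : W = ⟨0, 0, 0, -10012, 346900⟩) :
    |W.Δ| = 32 * 382623908456 ∧
      ∃ P : Fin 7 → W.toAffine.Point, LinearIndependent ℤ P := by
  have hΔ : W.Δ = 32 * 382623908456 := by
    subst hW
    norm_num [WeierstrassCurve.Δ, WeierstrassCurve.b₂, WeierstrassCurve.b₄, WeierstrassCurve.b₆,
      WeierstrassCurve.b₈]
  refine ⟨by rw [hΔ]; norm_num, ?_⟩
  let x : Fin 7 → ℤ := ![4, 12, 33, 42, 82, 102, 124]
  let y : Fin 7 → ℤ := ![554, 478, 229, 22, 278, 622, 1006]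
  have hxy : ∀ i, W.toAffine.Nonsingular (x i) (y i) := by
    intro i
    refine (WeierstrassCurve.Affine.equation_iff_nonsingular_of_Δ_ne_zero
      (by rw [hΔ]; norm_num)).mp ?_
    subst hW
    rw [WeierstrassCurve.Affine.equation_iff]
    fin_cases i <;> norm_num [x, y]
  have hchar : ∀ i, ∃ p : ℕ, ∃ _ : Fact p.Prime, ∃ r : ℤ,
      (p : ℤ) ∣ r ^ 3 + (-10012) * r + 346900 ∧ ¬ (p : ℤ) ∣ 3 * r ^ 2 + (-10012) ∧
        ∀ j, legendreSym p (x j - r) = if j = i then -1 else 1 := by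
    have hp (p : ℕ) (h : p.Prime) (r : ℤ) := fun i h' ↦
      (⟨p, ⟨h⟩, r, h'⟩ : ∃ p : ℕ, ∃ _ : Fact p.Prime, ∃ r : ℤ,
        (p : ℤ) ∣ r ^ 3 + (-10012) * r + 346900 ∧ ¬ (p : ℤ) ∣ 3 * r ^ 2 + (-10012) ∧
          ∀ j, legendreSym p (x j - r) = if j = i then -1 else 1)
    intro i
    fin_cases i
    · refine hp 419 (by norm_num) 195 _ ⟨by norm_num, by norm_num, fun j ↦ ?_⟩
      fin_cases j <;> norm_num [x]
    · refine hp 509 (by norm_num) 58 _ ⟨by norm_num, by norm_num, fun j ↦ ?_⟩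
      fin_cases j <;> norm_num [x]
    · refine hp 233 (by norm_num) 173 _ ⟨by norm_num, by norm_num, fun j ↦ ?_⟩
      fin_cases j <;> norm_num [x]
    · refine hp 61 (by norm_num) 60 _ ⟨by norm_num, by norm_num, fun j ↦ ?_⟩
      fin_cases j <;> norm_num [x]
    · refine hp 373 (by norm_num) 29 _ ⟨by norm_num, by norm_num, fun j ↦ ?_⟩
      fin_cases j <;> norm_num [x]
    · refine hp 479 (by norm_num) 422 _ ⟨by norm_num, by norm_num, fun j ↦ ?_⟩
      fin_cases j <;> norm_num [x]
    · refine hp 193 (by norm_num) 54 _ ⟨by norm_num, by norm_num, fun j ↦ ?_⟩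
      fin_cases j <;> norm_num [x]
  refine ⟨fun i ↦ .some _ _ (hxy i), linearIndependent_int_of_sum_ne_two_nsmul
    (fun P hP ↦ WeierstrassCurve.Affine.Point.eq_zero_of_two_nsmul_eq_zero (by rw [hW])
      (by rw [hW]) (fun x ↦ by simpa [hW] using cubic_ne_zero x) hP) fun S Q hQ ↦ ?_⟩
  refine Finset.eq_empty_of_forall_notMem fun i hi ↦ ?_
  obtain ⟨p, _, r, hr, hr', hleg⟩ := hchar i
  have h := prod_legendreSym_eq_one (by rw [hW]; norm_num) cubic_ne_zero hr hr' hxy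
    (fun j _ ↦ by rw [hleg]; split_ifs <;> norm_num) hQ
  simp [hleg, Finset.prod_ite_eq', hi] at h
end

section
/- The elliptic curve over Q given by the Weierstrass equation y^2 + y = x^3 - 16312387x + 25970162646 (coefficients [a1,a2,a3,a4,a6] = [0,0,1,-16312387,25970162646]) has discriminant of absolute value 1331 * 10189285026863130793, and its group of rational points contains 10 points that are linearly independent over Z (so the curve has Mordell–Weil rank at least 10). -/
open Polynomial

namespace WeierstrassCurve

section Descent

variable {K L : Type*} [Field K] [Field L] [Algebra K L] {W : WeierstrassCurve K} {θ : L}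

/-- The 2-descent map `(x, y) ↦ x - θ` on affine points, with value `1` at infinity. -/
def descentMap (θ : L) : W.toAffine.Point → L
  | 0 => 1
  | .some x _ _ => algebraMap K L x - θ

@[simp]
lemma descentMap_zero : descentMap θ (0 : W.toAffine.Point) = 1 := rfl

@[simp]
lemma descentMap_some {x y : K} (h : W.toAffine.Nonsingular x y) :
    descentMap θ (.some x y h) = algebraMap K L x - θ := rfl

lemma descentMap_ne_zero (hK : ∀ x : K, algebraMap K L x ≠ θ) (P : W.toAffine.Point) :
    descentMap θ P ≠ 0 := by
  rcases P with _ | ⟨x, y, h⟩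
  · exact one_ne_zero
  · exact sub_ne_zero.mpr (hK x)

lemma descentMap_neg (P : W.toAffine.Point) : descentMap θ (-P) = descentMap θ P := by
  rcases P with _ | ⟨x, y, h⟩ <;> rfl

variable [DecidableEq K]

/-- The product of the values of the 2-descent map at three collinear points is a square. -/
lemma isSquare_descentMap_mul (h2 : (2 : L) ≠ 0)
    (hθ : aeval θ W.twoTorsionPolynomial.toPoly = 0) (P Q : W.toAffine.Point) :
    IsSquare (descentMap θ P * descentMap θ Q * descentMap θ (P + Q)) := by
  rcases P with _ | ⟨x₁, y₁, h₁⟩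
  · change IsSquare (1 * descentMap θ Q * descentMap θ (0 + Q))
    simp
  rcases Q with _ | ⟨x₂, y₂, h₂⟩
  · change IsSquare (descentMap θ (.some x₁ y₁ h₁) * 1 * descentMap θ (Affine.Point.some x₁ y₁ h₁ + 0))
    simp
  by_cases hxy : x₁ = x₂ ∧ y₁ = W.toAffine.negY x₂ y₂
  · rw [Affine.Point.add_of_Y_eq hxy.1 hxy.2]
    simp [hxy.1]
  rw [Affine.Point.add_some hxy]
  have key := congrArg (aeval θ) (Affine.addPolynomial_slope h₁.1 h₂.1 hxy)
  rw [Affine.addPolynomial_eq, Cubic.toPoly] at key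
  simp only [twoTorsionPolynomial, Cubic.toPoly, b₂, b₄, b₆] at hθ
  simp only [descentMap_some]
  generalize W.toAffine.slope x₁ x₂ y₁ y₂ = ℓ at key ⊢
  simp only [map_add, map_sub, map_mul, map_neg, map_pow, map_one, aeval_C, aeval_X,
    map_ofNat] at key hθ
  set φ := algebraMap K L
  refine ⟨(2 * (φ ℓ * (θ - φ x₁) + φ y₁) + φ W.a₁ * θ + φ W.a₃) / 2, ?_⟩
  field_simp
  linear_combination (-4) * key - hθ

/-- The points at which the 2-descent map attached to `θ` takes square values. -/
def descentSubgroup (h2 : (2 : L) ≠ 0) (hθ : aeval θ W.twoTorsionPolynomial.toPoly = 0)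
    (hK : ∀ x : K, algebraMap K L x ≠ θ) : AddSubgroup W.toAffine.Point where
  carrier := {P | IsSquare (descentMap θ P)}
  zero_mem' := by simp
  neg_mem' {P} hP := by simpa [descentMap_neg] using hP
  add_mem' {P Q} hP hQ := by
    have h := (isSquare_descentMap_mul h2 hθ P Q).div (hP.mul hQ)
    rwa [mul_div_cancel_left₀ _
      (mul_ne_zero (descentMap_ne_zero hK P) (descentMap_ne_zero hK Q))] at h

lemma add_self_mem_descentSubgroup (h2 : (2 : L) ≠ 0)
    (hθ : aeval θ W.twoTorsionPolynomial.toPoly = 0) (hK : ∀ x : K, algebraMap K L x ≠ θ)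
    (P : W.toAffine.Point) : P + P ∈ descentSubgroup h2 hθ hK := by
  have hP := descentMap_ne_zero hK P
  have h := (isSquare_descentMap_mul h2 hθ P P).div (IsSquare.mul_self (descentMap θ P))
  rwa [mul_div_cancel_left₀ _ (mul_ne_zero hP hP)] at h

/-- A point of order two gives a root of the 2-torsion polynomial. -/
lemma eq_zero_of_add_self_eq_zero (hK : ∀ x : K, W.twoTorsionPolynomial.toPoly.eval x ≠ 0)
    {P : W.toAffine.Point} (hP : P + P = 0) : P = 0 := by
  rcases P with _ | ⟨x, y, h⟩
  · rfl
  by_cases hy : y = W.toAffine.negY x y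
  · refine absurd ?_ (hK x)
    have heq := (Affine.equation_iff ..).mp h.1
    rw [Affine.negY] at hy
    simp only [twoTorsionPolynomial, Cubic.toPoly, b₂, b₄, b₆, eval_add, eval_mul, eval_C,
      eval_pow, eval_X]
    linear_combination (-4) * heq + (2 * y + W.a₁ * x + W.a₃) * hy
  · rw [Affine.Point.add_self_of_Y_ne hy] at hP
    exact absurd hP (Affine.Point.some_ne_zero _)

end Descent

end WeierstrassCurve

namespace PadicInt

variable {p : ℕ} [Fact p.Prime]

lemma norm_lt_one_iff_toZMod_eq_zero {u : ℤ_[p]} : ‖u‖ < 1 ↔ toZMod u = 0 := by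
  rw [← RingHom.mem_ker, ker_toZMod, IsLocalRing.mem_maximalIdeal, mem_nonunits]

lemma norm_eq_one_iff_toZMod_ne_zero {u : ℤ_[p]} : ‖u‖ = 1 ↔ toZMod u ≠ 0 := by
  rw [ne_eq, ← norm_lt_one_iff_toZMod_eq_zero, not_lt]
  exact ⟨fun h => h.ge, fun h => le_antisymm (norm_le_one u) h⟩

/-- Hensel's lemma for a simple root modulo `p`. -/
lemma exists_root_of_toZMod {F : ℤ_[p][X]} {a : ℤ_[p]} (h : toZMod (F.eval a) = 0)
    (h' : toZMod (F.derivative.eval a) ≠ 0) :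
    ∃ z : ℤ_[p], F.eval z = 0 ∧ toZMod z = toZMod a := by
  have h1 := norm_eq_one_iff_toZMod_ne_zero.mpr h'
  obtain ⟨z, hz, hza, -⟩ := hensels_lemma (F := F) (a := a) (by
    simpa only [coe_aeval_eq_eval, h1, one_pow] using norm_lt_one_iff_toZMod_eq_zero.mpr h)
  simp only [coe_aeval_eq_eval, h1] at hz hza
  refine ⟨z, hz, ?_⟩
  rwa [norm_lt_one_iff_toZMod_eq_zero, map_sub, sub_eq_zero] at hza

lemma isSquare_of_isSquare_toZMod (hp : (2 : ZMod p) ≠ 0) {u : ℤ_[p]} (hu : toZMod u ≠ 0)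
    (h : IsSquare (toZMod u)) : IsSquare u := by
  obtain ⟨r, hr⟩ := h
  obtain ⟨s, rfl⟩ := ZMod.ringHom_surjective (toZMod (p := p)) r
  obtain ⟨z, hz, -⟩ := exists_root_of_toZMod (F := X ^ 2 - C u) (a := s)
    (by simp [hr, sq]) (by
      have hs : toZMod s ≠ 0 := fun h0 => hu (by rw [hr, h0, mul_zero])
      have h2 : toZMod (2 : ℤ_[p]) ≠ 0 := by rwa [map_ofNat]
      simpa [one_add_one_eq_two] using ⟨h2, hs⟩)
  exact ⟨z, by simpa [sub_eq_zero, sq, eq_comm] using hz⟩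

lemma isSquare_toZMod_of_isSquare_coe {u : ℤ_[p]} (h : IsSquare (u : ℚ_[p])) :
    IsSquare (toZMod u) := by
  obtain ⟨g, hg⟩ := h
  have hg1 : ‖g‖ ≤ 1 := by
    have := norm_le_one u
    rw [norm_def, hg, norm_mul] at this
    nlinarith [norm_nonneg g]
  have hsq : IsSquare u := ⟨(⟨g, hg1⟩ : ℤ_[p]), Subtype.ext hg⟩
  exact hsq.map toZMod

end PadicInt

/-- Elements separated by subgroups containing all doubles are independent in a group without
2-torsion. -/
lemma linearIndependent_of_separating_subgroups {G ι : Type*} [AddCommGroup G] [Fintype ι]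
    (h2 : ∀ g : G, g + g = 0 → g = 0) {P : ι → G} (H : ι → AddSubgroup G)
    (hdbl : ∀ i g, g + g ∈ H i) (hmem : ∀ i k, k ≠ i → P k ∈ H i) (hnot : ∀ i, P i ∉ H i) :
    LinearIndependent ℤ P := by
  classical
  rw [Fintype.linearIndependent_iff]
  have heven : ∀ c : ι → ℤ, ∑ k, c k • P k = 0 → ∀ i, Even (c i) := by
    intro c hc i
    by_contra hodd
    obtain ⟨m, hm⟩ := Int.not_even_iff_odd.mp hodd
    rw [← Finset.add_sum_erase _ _ (Finset.mem_univ i)] at hc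
    have hci : c i • P i ∈ H i := by
      rw [eq_neg_of_add_eq_zero_left hc]
      exact neg_mem (sum_mem fun k hk => zsmul_mem (hmem i k (Finset.ne_of_mem_erase hk)) _)
    rw [hm, add_smul, one_smul, two_mul, add_smul] at hci
    exact hnot i (((H i).add_mem_cancel_left (hdbl i _)).mp hci)
  have hpow : ∀ (n : ℕ) (c : ι → ℤ), ∑ k, c k • P k = 0 → ∀ i, (2 : ℤ) ^ n ∣ c i := by
    intro n
    induction n with
    | zero => simp
    | succ n ih =>
      intro c hc i
      choose d hd using heven c hc
      have hd0 : ∑ k, d k • P k = 0 := h2 _ (by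
        simpa only [← Finset.sum_add_distrib, ← add_smul, ← hd] using hc)
      rw [hd i, ← two_mul, pow_succ']
      exact mul_dvd_mul_left 2 (ih d hd0 i)
  intro c hc i
  refine Int.eq_zero_of_abs_lt_dvd (hpow (c i).natAbs c hc i) ?_
  rw [Int.abs_eq_natAbs]
  exact_mod_cast Nat.lt_two_pow_self

open WeierstrassCurve in
/-- A simple root `a` modulo `p` of the 2-torsion polynomial yields a subgroup containing all
doubles, in which membership of integral points is read off from a Legendre symbol. -/
lemma exists_subgroup_of_root_mod (E : WeierstrassCurve ℤ) (p : ℕ) [Fact p.Prime]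
    (hp : (2 : ZMod p) ≠ 0)
    (hK : ∀ x : ℚ, (E.map (Int.castRingHom ℚ)).twoTorsionPolynomial.toPoly.eval x ≠ 0) (a : ℤ)
    (ha : ((E.twoTorsionPolynomial.toPoly.eval a : ℤ) : ZMod p) = 0)
    (ha' : ((E.twoTorsionPolynomial.toPoly.derivative.eval a : ℤ) : ZMod p) ≠ 0) :
    ∃ H : AddSubgroup (E.map (Int.castRingHom ℚ)).toAffine.Point, (∀ P, P + P ∈ H) ∧
      ∀ (n : ℤ) (y : ℚ) (h : (E.map (Int.castRingHom ℚ)).toAffine.Nonsingular n y),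
        (legendreSym p (n - a) = 1 → .some _ _ h ∈ H) ∧
        (legendreSym p (n - a) = -1 → .some _ _ h ∉ H) := by
  set F := E.twoTorsionPolynomial.toPoly
  have hF : (E.map (Int.castRingHom ℚ)).twoTorsionPolynomial.toPoly =
      F.map (Int.castRingHom ℚ) := by
    rw [← Cubic.map_toPoly]
    simp [twoTorsionPolynomial, Cubic.map]
  obtain ⟨z, hz, hza⟩ := PadicInt.exists_root_of_toZMod
    (F := F.map (Int.castRingHom ℤ_[p])) (a := (a : ℤ_[p]))
    (by rwa [eval_intCast_map, eq_intCast, map_intCast])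
    (by rwa [derivative_map, eval_intCast_map, eq_intCast, map_intCast])
  rw [map_intCast] at hza
  have hθ : aeval (z : ℚ_[p])
      (E.map (Int.castRingHom ℚ)).twoTorsionPolynomial.toPoly = 0 := by
    have := congrArg (PadicInt.Coe.ringHom (p := p)) hz
    rw [eval_map, hom_eval₂, map_zero] at this
    rw [hF, aeval_def, eval₂_map]
    convert this using 2
    · exact RingHom.ext_int _ _
    · rfl
  have hθK : ∀ x : ℚ, algebraMap ℚ ℚ_[p] x ≠ z := by
    intro x hx
    rw [← hx, aeval_algebraMap_apply, coe_aeval_eq_eval] at hθ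
    exact hK x ((map_eq_zero _).mp hθ)
  refine ⟨descentSubgroup two_ne_zero hθ hθK, add_self_mem_descentSubgroup _ _ _,
    fun n y h => ?_⟩
  have hmem : .some _ _ h ∈ descentSubgroup two_ne_zero hθ hθK ↔
      IsSquare (((n : ℤ_[p]) - z : ℤ_[p]) : ℚ_[p]) := by
    change IsSquare (_ - _) ↔ _
    simp
  have hres : PadicInt.toZMod ((n : ℤ_[p]) - z) = ((n - a : ℤ) : ZMod p) := by
    simp [hza]
  rw [hmem]
  constructor
  · intro h1
    have hne : ((n - a : ℤ) : ZMod p) ≠ 0 := by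
      rw [ne_eq, ← legendreSym.eq_zero_iff, h1]
      exact one_ne_zero
    obtain ⟨g, hg⟩ := PadicInt.isSquare_of_isSquare_toZMod hp (hres ▸ hne)
      (hres ▸ (legendreSym.eq_one_iff p hne).mp h1)
    exact ⟨g, by rw [hg, PadicInt.coe_mul]⟩
  · intro h1 hsq
    exact (legendreSym.eq_neg_one_iff p).mp h1
      (hres ▸ PadicInt.isSquare_toZMod_of_isSquare_coe hsq)

namespace RankTenCurve

/-- The integral model of the curve. -/
def model : WeierstrassCurve ℤ := ⟨0, 0, 1, -16312387, 25970162646⟩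

/-- The abscissae of ten independent integral points. -/
def abscissa : Fin 10 → ℤ :=
  ![-4674, -4672, -4654, -4628, -4617, -4523, -4509, -4476, -4289, -4177]

/-- The ordinates of ten independent integral points. -/
def ordinate : Fin 10 → ℤ :=
  ![10235, 14253, 32919, 48369, 53528, 84980, 88599, 96486, 130520, 145703]

/-- Primes whose descent maps separate the ten points. -/
def separatingPrime : Fin 10 → ℕ :=
  ![9907, 199, 3137, 21841, 4799, 3517, 15973, 2677, 937, 1693]

/-- Roots of the 2-torsion polynomial modulo the separating primes. -/
def separatingRoot : Fin 10 → ℤ :=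
  ![4906, 36, 19, 983, 2487, 2897, 10101, 2652, 65, 849]

lemma prime_separatingPrime (i : Fin 10) : (separatingPrime i).Prime := by
  fin_cases i <;> norm_num [separatingPrime]

instance (i : Fin 10) : Fact (separatingPrime i).Prime := ⟨prime_separatingPrime i⟩

lemma legendreSym_abscissa (i k : Fin 10) :
    legendreSym (separatingPrime i) (abscissa k - separatingRoot i) = if k = i then -1 else 1 := by
  rw [jacobiSym.legendreSym.to_jacobiSym]
  fin_cases i <;> fin_cases k <;> simp [separatingPrime, separatingRoot, abscissa] <;> norm_num

lemma eval_twoTorsionPolynomial (x : ℤ) : model.twoTorsionPolynomial.toPoly.eval x =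
    4 * x ^ 3 - 65249548 * x + 103880650585 := by
  simp [model, WeierstrassCurve.twoTorsionPolynomial, Cubic.toPoly, WeierstrassCurve.b₂,
    WeierstrassCurve.b₄, WeierstrassCurve.b₆]
  ring

lemma eval_derivative_twoTorsionPolynomial (x : ℤ) :
    model.twoTorsionPolynomial.toPoly.derivative.eval x = 12 * x ^ 2 - 65249548 := by
  simp [model, WeierstrassCurve.twoTorsionPolynomial, Cubic.toPoly, WeierstrassCurve.b₂,
    WeierstrassCurve.b₄, WeierstrassCurve.b₆]
  ring

lemma twoTorsionPolynomial_eval_ne_zero (x : ℚ) :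
    (model.map (Int.castRingHom ℚ)).twoTorsionPolynomial.toPoly.eval x ≠ 0 := by
  intro hx
  simp [model, WeierstrassCurve.twoTorsionPolynomial, Cubic.toPoly, WeierstrassCurve.b₂,
    WeierstrassCurve.b₄, WeierstrassCurve.b₆] at hx
  have hint : IsIntegral ℤ (4 * x) := by
    refine ⟨X ^ 3 - C 260998192 * X + C 1662090409360, by monicity!, ?_⟩
    simp
    linear_combination 16 * hx
  obtain ⟨m, hm⟩ := IsIntegrallyClosed.isIntegral_iff.mp hint
  have hmz : m ^ 3 - 260998192 * m + 1662090409360 = 0 := by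
    have : (m : ℚ) ^ 3 - 260998192 * m + 1662090409360 = 0 := by
      have hm' : (m : ℚ) = 4 * x := hm
      rw [hm']
      linear_combination 16 * hx
    exact_mod_cast this
  have hmod := congrArg (Int.cast : ℤ → ZMod 7) hmz
  push_cast at hmod
  generalize (m : ZMod 7) = r at hmod
  revert hmod r
  decide

lemma Δ_model : model.Δ = -13561938370754827085483 := by
  norm_num [model, WeierstrassCurve.Δ, WeierstrassCurve.b₂, WeierstrassCurve.b₄,
    WeierstrassCurve.b₆, WeierstrassCurve.b₈]

lemma nonsingular (i : Fin 10) :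
    (model.map (Int.castRingHom ℚ)).toAffine.Nonsingular (abscissa i) (ordinate i) := by
  rw [← WeierstrassCurve.Affine.equation_iff_nonsingular_of_Δ_ne_zero,
    WeierstrassCurve.Affine.equation_iff]
  · fin_cases i <;> norm_num [model, abscissa, ordinate]
  · rw [WeierstrassCurve.map_Δ, Δ_model]
    norm_num

theorem linearIndependent_points :
    LinearIndependent ℤ fun i => WeierstrassCurve.Affine.Point.some _ _ (nonsingular i) := by
  have hsub (i : Fin 10) := exists_subgroup_of_root_mod model (separatingPrime i)
    (by
      have : ((2 : ℕ) : ZMod (separatingPrime i)) ≠ 0 := by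
        rw [ne_eq, ZMod.natCast_eq_zero_iff]
        fin_cases i <;> norm_num [separatingPrime]
      exact_mod_cast this)
    twoTorsionPolynomial_eval_ne_zero (separatingRoot i)
    (by
      rw [eval_twoTorsionPolynomial, ZMod.intCast_zmod_eq_zero_iff_dvd]
      fin_cases i <;> norm_num [separatingPrime, separatingRoot])
    (by
      rw [eval_derivative_twoTorsionPolynomial, ne_eq, ZMod.intCast_zmod_eq_zero_iff_dvd]
      fin_cases i <;> norm_num [separatingPrime, separatingRoot])
  choose H hdbl hmem using hsub
  refine linearIndependent_of_separating_subgroups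
    (fun _ => WeierstrassCurve.eq_zero_of_add_self_eq_zero twoTorsionPolynomial_eval_ne_zero)
    H hdbl (fun i k hki => (hmem i _ _ _).1 ?_) (fun i => (hmem i _ _ _).2 ?_)
  · rw [legendreSym_abscissa, if_neg hki]
  · rw [legendreSym_abscissa, if_pos rfl]

end RankTenCurve


/-- The elliptic curve `[0, 0, 1, -16312387, 25970162646]` has discriminant of absolute value `1331 * 10189285026863130793`,
and its group of rational points contains `10` points that are linearly independent
over `ℤ` (so its Mordell–Weil rank is at least `10`). -/
theorem rank10_low_conductor_curve (W : WeierstrassCurve ℚ)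
    (hW : W = ⟨0, 0, 1, -16312387, 25970162646⟩) :
    |W.Δ| = 1331 * 10189285026863130793 ∧
      ∃ P : Fin 10 → W.toAffine.Point, LinearIndependent ℤ P := by
  have hmodel : W = RankTenCurve.model.map (Int.castRingHom ℚ) := by
    rw [hW]
    ext <;> simp [RankTenCurve.model]
  subst hmodel
  refine ⟨?_, _, RankTenCurve.linearIndependent_points⟩
  rw [WeierstrassCurve.map_Δ, RankTenCurve.Δ_model]
  norm_num
end

section
/- The elliptic curve over Q given by the Weierstrass equation y^2 + xy = x^3 - 9227x + 340354 (coefficients [a1,a2,a3,a4,a6] = [1,0,0,-9227,340354]) has discriminant of absolute value 6822208199, and its group of rational points contains 6 points that are linearly independent over Z (so the curve has Mordell–Weil rank at least 6). -/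
open Polynomial

namespace WeierstrassCurve.Affine

variable {F K : Type*} [Field F] [Field K] [Algebra F K] {W : Affine F}

/-- For three collinear points of a Weierstrass curve and a root `θ` of the `2`-division polynomial,
the product of the values of `X - θ` at the points is, up to the factor `4`, a square. -/
lemma four_mul_prod_sub_root [DecidableEq F] {θ : K} (hθ : aeval θ W.Ψ₂Sq = 0) {x₁ x₂ y₁ y₂ : F}
    (h₁ : W.Equation x₁ y₁) (h₂ : W.Equation x₂ y₂) (hxy : ¬(x₁ = x₂ ∧ y₁ = W.negY x₂ y₂)) :
    ∃ t : K, 4 * ((algebraMap F K x₁ - θ) * (algebraMap F K x₂ - θ) *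
      (algebraMap F K (W.addX x₁ x₂ (W.slope x₁ x₂ y₁ y₂)) - θ)) = t ^ 2 := by
  have h := congrArg (aeval θ) (addPolynomial_slope h₁ h₂ hxy)
  simp only [addPolynomial_eq, Cubic.toPoly, map_neg, map_add, map_sub, map_mul, map_pow,
    aeval_C, aeval_X] at h
  simp only [map_ofNat, map_one] at h
  simp only [Ψ₂Sq, b₂, b₄, b₆, map_add, map_mul, map_pow, aeval_C, aeval_X, map_ofNat] at hθ
  refine ⟨2 * (algebraMap F K (W.slope x₁ x₂ y₁ y₂) * (θ - algebraMap F K x₁) + algebraMap F K y₁)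
    + algebraMap F K W.a₁ * θ + algebraMap F K W.a₃, ?_⟩
  linear_combination (-4) * h - hθ

/-- The composition of the `2`-descent map `(x, y) ↦ x - θ` with a quadratic character `χ`. -/
noncomputable def descentHom [DecidableEq F] (h2 : (2 : K) ≠ 0) (θ : K)
    (hθ : aeval θ W.Ψ₂Sq = 0) (hF : ∀ x : F, algebraMap F K x ≠ θ) (χ : Kˣ →* ℤˣ) :
    W.Point →+ Additive ℤˣ where
  toFun
    | .zero => 0
    | .some x _ _ => .ofMul <| χ <| Units.mk0 (algebraMap F K x - θ) <| sub_ne_zero.2 <| hF x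
  map_zero' := rfl
  map_add' := by
    rintro (_ | ⟨x₁, y₁, h₁⟩) (_ | ⟨x₂, y₂, h₂⟩)
    · rfl
    · rw [← Point.zero_def, zero_add]; exact (zero_add _).symm
    · rw [← Point.zero_def, add_zero]; exact (add_zero _).symm
    · by_cases hxy : x₁ = x₂ ∧ y₁ = W.negY x₂ y₂
      · rw [Point.add_of_Y_eq hxy.1 hxy.2]
        obtain ⟨rfl, -⟩ := hxy
        exact congrArg Additive.ofMul (Int.units_mul_self _).symm
      · rw [Point.add_some hxy]
        obtain ⟨t, ht⟩ := four_mul_prod_sub_root hθ h₁.1 h₂.1 hxy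
        set x₃ := W.addX x₁ x₂ (W.slope x₁ x₂ y₁ y₂)
        have hu (x : F) := sub_ne_zero.2 (hF x)
        have h4 : (4 : K) = 2 ^ 2 := by norm_num
        have ht0 : t ≠ 0 := by
          rintro rfl
          refine mul_ne_zero (h4 ▸ pow_ne_zero 2 h2)
            (mul_ne_zero (mul_ne_zero (hu x₁) (hu x₂)) (hu x₃)) (by simpa using ht)
        have key : Units.mk0 _ h2 ^ 2 *
            (Units.mk0 _ (hu x₁) * Units.mk0 _ (hu x₂) * Units.mk0 _ (hu x₃)) =
            Units.mk0 t ht0 ^ 2 := by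
          ext
          simpa [h4] using ht
        replace key := congrArg χ key
        simp only [map_mul, map_pow, Int.units_sq, one_mul] at key
        change Additive.ofMul (χ (Units.mk0 _ (hu x₃))) = .ofMul
          (χ (Units.mk0 _ (hu x₁)) * χ (Units.mk0 _ (hu x₂)))
        rw [mul_eq_one_iff_eq_inv, Int.units_inv_eq_self] at key
        rw [key]

lemma descentHom_some [DecidableEq F] (h2 : (2 : K) ≠ 0) (θ : K)
    (hθ : aeval θ W.Ψ₂Sq = 0) (hF : ∀ x : F, algebraMap F K x ≠ θ) (χ : Kˣ →* ℤˣ)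
    {x y : F} (h : W.Nonsingular x y) :
    descentHom h2 θ hθ hF χ (.some x y h) =
      .ofMul (χ (Units.mk0 (algebraMap F K x - θ) (sub_ne_zero.2 (hF x)))) :=
  rfl

/-- A curve whose `2`-division polynomial has no root has no `2`-torsion. -/
lemma eq_zero_of_two_smul_eq_zero [DecidableEq F] (hW : ∀ x : F, W.Ψ₂Sq.eval x ≠ 0)
    {P : W.Point} (hP : (2 : ℤ) • P = 0) : P = 0 := by
  obtain _ | ⟨x, y, h⟩ := P
  · rfl
  · rw [two_smul, add_eq_zero_iff_eq_neg, Point.neg_some, Point.some.injEq] at hP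
    refine absurd ?_ (hW x)
    have he := (W.equation_iff x y).1 h.1
    have hy := hP.2
    rw [negY] at hy
    simp only [Ψ₂Sq, b₂, b₄, b₆, eval_add, eval_mul, eval_C, eval_pow, eval_X]
    linear_combination (2 * y + W.a₁ * x + W.a₃) * hy - 4 * he

end WeierstrassCurve.Affine

section Padic

variable {p : ℕ} [Fact p.Prime]

/-- The unit part `z / p ^ v(z)` of a nonzero `p`-adic number `z`. -/
noncomputable def padicUnitPart : ℚ_[p]ˣ →* ℤ_[p] where
  toFun z := ⟨z * (p : ℚ_[p]) ^ (-(z : ℚ_[p]).valuation), by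
    have hp : (p : ℝ) ≠ 0 := by exact_mod_cast (Fact.out : p.Prime).ne_zero
    rw [norm_mul, norm_zpow, Padic.norm_p, Padic.norm_eq_zpow_neg_valuation z.ne_zero, inv_zpow',
      neg_neg, ← zpow_add₀ hp]
    simp⟩
  map_one' := Subtype.ext (by simp)
  map_mul' z w := by
    have hp : (p : ℚ_[p]) ≠ 0 := by exact_mod_cast (Fact.out : p.Prime).ne_zero
    apply Subtype.ext
    simp only [Units.val_mul, Padic.valuation_mul z.ne_zero w.ne_zero, neg_add, zpow_add₀ hp]
    exact mul_mul_mul_comm _ _ _ _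

/-- The Legendre symbol of the unit part of a nonzero `p`-adic number. -/
noncomputable def padicQuadraticChar : ℚ_[p]ˣ →* ℤˣ :=
  (((quadraticChar (ZMod p)).toMonoidHom.comp
    (PadicInt.toZMod (p := p)).toMonoidHom).comp padicUnitPart).toHomUnits

lemma padicQuadraticChar_of_isUnit (z : ℚ_[p]ˣ) {u : ℤ_[p]} (hu : IsUnit u)
    (hz : (z : ℚ_[p]) = u) :
    (padicQuadraticChar z : ℤ) = quadraticChar (ZMod p) (PadicInt.toZMod u) := by
  have hv : (z : ℚ_[p]).valuation = 0 := by
    have h := Padic.norm_eq_zpow_neg_valuation z.ne_zero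
    rw [hz, ← PadicInt.norm_def, PadicInt.isUnit_iff.1 hu, ← hz, eq_comm,
      zpow_eq_one_iff_right₀ (by positivity)
        (by exact_mod_cast (Fact.out : p.Prime).ne_one), neg_eq_zero] at h
    exact h
  have : padicUnitPart z = u := by
    apply Subtype.ext
    change (z : ℚ_[p]) * (p : ℚ_[p]) ^ (-(z : ℚ_[p]).valuation) = u
    rw [hv, neg_zero, zpow_zero, mul_one, hz]
  change quadraticChar (ZMod p) (PadicInt.toZMod (padicUnitPart z)) = _
  rw [this]

lemma exists_padicInt_root (f : ℤ[X]) {a : ℤ} (hf : (p : ℤ) ∣ f.eval a)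
    (hf' : ¬ (p : ℤ) ∣ f.derivative.eval a) :
    ∃ θ : ℤ_[p], aeval θ f = 0 ∧ PadicInt.toZMod θ = (a : ZMod p) := by
  have haeval (g : ℤ[X]) : aeval (a : ℤ_[p]) g = (g.eval a : ℤ) := by
    simpa using aeval_algebraMap_apply ℤ_[p] a g
  have hd : ‖((f.derivative.eval a : ℤ) : ℤ_[p])‖ = 1 :=
    le_antisymm (PadicInt.norm_le_one _)
      (not_lt.1 fun h ↦ hf' ((PadicInt.norm_int_lt_one_iff_dvd _).1 h))
  obtain ⟨θ, hθ, hlt, -⟩ := hensels_lemma (F := f) (a := (a : ℤ_[p])) (by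
    rw [haeval, haeval, hd, one_pow]
    exact (PadicInt.norm_int_lt_one_iff_dvd _).2 hf)
  refine ⟨θ, hθ, ?_⟩
  rw [haeval, hd] at hlt
  have : θ - a ∈ RingHom.ker (PadicInt.toZMod (p := p)) := by
    rw [PadicInt.ker_toZMod]
    exact PadicInt.mem_nonunits.2 hlt
  simpa [RingHom.mem_ker, sub_eq_zero] using this

end Padic

/-- Vectors that are separated by a dual family of sign characters are linearly independent in a
group without `2`-torsion. -/
lemma linearIndependent_int_of_sign_characters {ι A : Type*} [Fintype ι] [DecidableEq ι]
    [AddCommGroup A] (hA : ∀ a : A, (2 : ℤ) • a = 0 → a = 0) (P : ι → A)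
    (φ : ι → A →+ Additive ℤˣ)
    (hφ : ∀ i j, φ i (P j) = Additive.ofMul (if i = j then -1 else 1)) :
    LinearIndependent ℤ P := by
  rw [Fintype.linearIndependent_iff]
  intro c hc i
  have key : ∀ (n : ℕ) (c : ι → ℤ), ∑ i, c i • P i = 0 → ∀ i, (2 : ℤ) ^ n ∣ c i := by
    intro n
    induction n with
    | zero => simp
    | succ n ih =>
      intro c hc
      have heven (i : ι) : ∃ d, c i = 2 * d := by
        have h := congrArg (φ i) hc
        rw [map_sum, map_zero, Finset.sum_eq_single i (fun j _ hj ↦ by simp [hφ, hj.symm])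
          (by simp), map_zsmul, hφ, if_pos rfl] at h
        replace h : (-1 : ℤˣ) ^ c i = 1 := h
        rcases Int.even_or_odd (c i) with he | ho
        · exact he.two_dvd
        · rw [ho.neg_one_zpow] at h
          exact absurd h (by decide)
      choose d hd using heven
      have hd0 : ∑ i, d i • P i = 0 := hA _ <| by
        rw [Finset.smul_sum, ← hc]
        exact Finset.sum_congr rfl fun i _ ↦ by rw [hd, mul_smul]
      intro i
      rw [hd, pow_succ']
      exact mul_dvd_mul_left 2 (ih d hd0 i)
  refine Int.eq_zero_of_abs_lt_dvd (key (c i).natAbs c hc i) ?_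
  rw [Int.abs_eq_natAbs]
  exact_mod_cast Nat.lt_two_pow_self

namespace LowDiscriminantCurve

/-- The curve `[1, 0, 0, -9227, 340354]`. -/
abbrev curve : WeierstrassCurve ℚ := ⟨1, 0, 0, -9227, 340354⟩

/-- The `2`-division polynomial of `curve`, with integer coefficients. -/
noncomputable def twoDivisionPolynomial : ℤ[X] :=
  4 * X ^ 3 + X ^ 2 - 36908 * X + 1361416

lemma aeval_Ψ₂Sq {K : Type*} [Field K] [Algebra ℚ K] (θ : K) :
    aeval θ curve.Ψ₂Sq = aeval θ twoDivisionPolynomial := by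
  simp only [WeierstrassCurve.Ψ₂Sq, WeierstrassCurve.b₂, WeierstrassCurve.b₄,
    WeierstrassCurve.b₆, twoDivisionPolynomial, map_add, map_sub, map_mul, map_pow, aeval_X,
    map_ofNat, map_one, map_zero, map_neg]
  ring

lemma eval_Ψ₂Sq_ne_zero (x : ℚ) : curve.Ψ₂Sq.eval x ≠ 0 := by
  intro h
  rw [← coe_aeval_eq_eval, aeval_Ψ₂Sq] at h
  simp only [twoDivisionPolynomial, map_add, map_sub, map_mul, map_pow, aeval_X, map_ofNat] at h
  have hroot : aeval (4 * x) (X ^ 3 + X ^ 2 - 147632 * X + 21782656 : ℤ[X]) = 0 := by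
    simp only [map_add, map_sub, map_mul, map_pow, aeval_X, map_ofNat]
    linear_combination 16 * h
  obtain ⟨n, hn⟩ := isInteger_of_is_root_of_monic (by monicity!) hroot
  have hn' : n ^ 3 + n ^ 2 - 147632 * n + 21782656 = 0 := by
    have h4 : (n : ℚ) = 4 * x := by simpa using hn
    have : (n : ℚ) ^ 3 + n ^ 2 - 147632 * n + 21782656 = 0 := by
      rw [h4]
      linear_combination 16 * h
    exact_mod_cast this
  have h5 := congrArg (Int.cast : ℤ → ZMod 5) hn'
  push_cast at h5
  exact (by decide : ∀ m : ZMod 5, m ^ 3 + m ^ 2 - 147632 * m + 21782656 ≠ 0) _ h5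

lemma exists_sign_character (p : ℕ) [Fact p.Prime] (a : ℤ)
    (ha : (p : ℤ) ∣ 4 * a ^ 3 + a ^ 2 - 36908 * a + 1361416)
    (ha' : ¬ (p : ℤ) ∣ 12 * a ^ 2 + 2 * a - 36908) :
    ∃ φ : curve.toAffine.Point →+ Additive ℤˣ,
      ∀ (x y : ℤ) (h : curve.toAffine.Nonsingular (x : ℚ) (y : ℚ)) (ε : ℤˣ),
        legendreSym p (x - a) = ε → φ (.some x y h) = .ofMul ε := by
  obtain ⟨θ, hθ, hθa⟩ := exists_padicInt_root (p := p) twoDivisionPolynomial (a := a)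
    (by simpa [twoDivisionPolynomial] using ha)
    (by
      convert ha' using 2
      simp [twoDivisionPolynomial]
      ring)
  have hroot : aeval (θ : ℚ_[p]) curve.Ψ₂Sq = 0 := by
    rw [aeval_Ψ₂Sq]
    simpa [hθ] using aeval_algebraMap_apply ℚ_[p] θ twoDivisionPolynomial
  have hrat (x : ℚ) : algebraMap ℚ ℚ_[p] x ≠ θ := by
    intro hx
    rw [← hx, aeval_algebraMap_apply, map_eq_zero, coe_aeval_eq_eval] at hroot
    exact eval_Ψ₂Sq_ne_zero x hroot
  refine ⟨WeierstrassCurve.Affine.descentHom two_ne_zero _ hroot hrat padicQuadraticChar,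
    fun x y h ε hε ↦ ?_⟩
  rw [WeierstrassCurve.Affine.descentHom_some]
  congr 1
  have hmod : PadicInt.toZMod ((x : ℤ_[p]) - θ) = ((x - a : ℤ) : ZMod p) := by
    simp [hθa]
  have hunit : IsUnit ((x : ℤ_[p]) - θ) := by
    by_contra hu
    have : (x : ℤ_[p]) - θ ∈ RingHom.ker (PadicInt.toZMod (p := p)) := by
      rw [PadicInt.ker_toZMod]
      exact hu
    rw [RingHom.mem_ker, hmod, ← legendreSym.eq_zero_iff, hε] at this
    exact ε.ne_zero this
  ext
  rw [padicQuadraticChar_of_isUnit _ hunit (by simp), hmod, ← hε]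
  rfl

/-- Abscissas of six independent integral points. -/
def abscissa : Fin 6 → ℤ := ![-2, -10, -33, 39, 43, 45]

/-- Ordinates of six independent integral points. -/
def ordinate : Fin 6 → ℤ := ![600, 662, 797, 181, 132, 107]

lemma nonsingular (i : Fin 6) :
    curve.toAffine.Nonsingular (abscissa i : ℚ) (ordinate i : ℚ) := by
  rw [WeierstrassCurve.Affine.nonsingular_iff, WeierstrassCurve.Affine.equation_iff]
  fin_cases i <;> norm_num [abscissa, ordinate]

/-- For each `i`, a prime `p` at which only the `i`-th point fails to be locally a double. -/
lemma exists_dual_characters (i : Fin 6) : ∃ φ : curve.toAffine.Point →+ Additive ℤˣ,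
    ∀ j, φ (.some _ _ (nonsingular j)) = .ofMul (if i = j then -1 else 1) := by
  suffices ∃ (p : ℕ) (_ : Fact p.Prime) (a : ℤ),
      (p : ℤ) ∣ 4 * a ^ 3 + a ^ 2 - 36908 * a + 1361416 ∧
      ¬ (p : ℤ) ∣ 12 * a ^ 2 + 2 * a - 36908 ∧
      ∀ j, legendreSym p (abscissa j - a) = ((if i = j then -1 else 1 : ℤˣ) : ℤ) by
    obtain ⟨p, _, a, h, h', hj⟩ := this
    obtain ⟨φ, hφ⟩ := exists_sign_character p a h h'
    exact ⟨φ, fun j ↦ hφ _ _ _ _ (hj j)⟩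
  have : Fact (Nat.Prime 239) := ⟨by norm_num⟩
  have : Fact (Nat.Prime 43) := ⟨by norm_num⟩
  have : Fact (Nat.Prime 733) := ⟨by norm_num⟩
  have : Fact (Nat.Prime 53) := ⟨by norm_num⟩
  have : Fact (Nat.Prime 307) := ⟨by norm_num⟩
  have : Fact (Nat.Prime 347) := ⟨by norm_num⟩
  fin_cases i
  on_goal 1 => refine ⟨239, inferInstance, 9, by norm_num, by norm_num, fun j ↦ ?_⟩
  on_goal 2 => refine ⟨43, inferInstance, 28, by norm_num, by norm_num, fun j ↦ ?_⟩
  on_goal 3 => refine ⟨733, inferInstance, 222, by norm_num, by norm_num, fun j ↦ ?_⟩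
  on_goal 4 => refine ⟨53, inferInstance, 44, by norm_num, by norm_num, fun j ↦ ?_⟩
  on_goal 5 => refine ⟨307, inferInstance, 156, by norm_num, by norm_num, fun j ↦ ?_⟩
  on_goal 6 => refine ⟨347, inferInstance, 250, by norm_num, by norm_num, fun j ↦ ?_⟩
  all_goals fin_cases j <;> simp [abscissa] <;> norm_num

end LowDiscriminantCurve


/-- The elliptic curve `[1, 0, 0, -9227, 340354]` has discriminant of absolute value `6822208199`,
and its group of rational points contains `6` points that are linearly independent
over `ℤ` (so its Mordell–Weil rank is at least `6`). -/
theorem rank6_low_discriminant_curve (W : WeierstrassCurve ℚ)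
    (hW : W = ⟨1, 0, 0, -9227, 340354⟩) :
    |W.Δ| = 6822208199 ∧
      ∃ P : Fin 6 → W.toAffine.Point, LinearIndependent ℤ P := by
  subst hW
  constructor
  · norm_num [WeierstrassCurve.Δ, WeierstrassCurve.b₂, WeierstrassCurve.b₄, WeierstrassCurve.b₆,
      WeierstrassCurve.b₈]
  · choose φ hφ using LowDiscriminantCurve.exists_dual_characters
    exact ⟨_, linearIndependent_int_of_sign_characters
      (fun _ ↦ WeierstrassCurve.Affine.eq_zero_of_two_smul_eq_zero
        LowDiscriminantCurve.eval_Ψ₂Sq_ne_zero) _ φ hφ⟩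
end

section
/- The elliptic curve over Q given by the Weierstrass equation y^2 + y = x^3 - 167419x + 30261330 (coefficients [a1,a2,a3,a4,a6] = [0,0,1,-167419,30261330]) has discriminant of absolute value 95276302704064331, and its group of rational points contains 9 points that are linearly independent over Z (so the curve has Mordell–Weil rank at least 9). -/
open Polynomial

/-- In a `ℤ`-module without `2`-torsion, a finite family none of whose nonempty subsums is
divisible by `2` is linearly independent. -/
theorem linearIndependent_int_of_sum_ne_two_smul {ι M : Type*} [Fintype ι] [DecidableEq ι]
    [AddCommGroup M] {P : ι → M} (h2 : ∀ m : M, (2 : ℤ) • m = 0 → m = 0)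
    (hP : ∀ (S : Finset ι) (Q : M), ∑ i ∈ S, P i = (2 : ℤ) • Q → S = ∅) :
    LinearIndependent ℤ P := by
  have even_of_sum_eq_zero : ∀ c : ι → ℤ, ∑ i, c i • P i = 0 → ∀ i, 2 ∣ c i := by
    intro c hc i
    have hS := hP {i | ¬ 2 ∣ c i} (-∑ i, (c i / 2) • P i) (by
      rw [smul_neg, Finset.smul_sum, eq_neg_iff_add_eq_zero, Finset.sum_filter,
        ← Finset.sum_add_distrib]
      refine Eq.trans (Finset.sum_congr rfl fun i _ => ?_) hc
      split_ifs with h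
      · rw [smul_smul, Int.mul_ediv_cancel' h, zero_add]
      · rw [smul_smul]
        nth_rewrite 1 [← one_smul ℤ (P i)]
        rw [← add_smul]
        congr 1
        omega)
    by_contra h
    exact Finset.eq_empty_iff_forall_notMem.mp hS i
      (Finset.mem_filter.mpr ⟨Finset.mem_univ i, h⟩)
  have pow_dvd : ∀ (n : ℕ) (c : ι → ℤ), ∑ i, c i • P i = 0 → ∀ i, 2 ^ n ∣ c i := by
    intro n
    induction n with
    | zero => simp
    | succ n ih =>
      intro c hc i
      choose d hd using even_of_sum_eq_zero c hc
      have hd0 : ∑ i, d i • P i = 0 := h2 _ (by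
        rw [Finset.smul_sum, ← hc]
        exact Finset.sum_congr rfl fun i _ => by rw [smul_smul, hd i])
      rw [hd i, pow_succ']
      exact mul_dvd_mul_left 2 (ih d hd0 i)
  rw [Fintype.linearIndependent_iff]
  intro c hc i
  refine Int.eq_zero_of_abs_lt_dvd (pow_dvd (c i).natAbs c hc i) ?_
  rw [Int.abs_eq_natAbs]
  exact_mod_cast Nat.lt_two_pow_self

namespace WeierstrassCurve.Affine

variable {F K : Type*} [Field F] [Field K] [Algebra F K] {W : Affine F} {θ η : K}

/-- The `2`-descent map attached to the `x`-coordinate `θ` of a `2`-torsion point over `K`: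
a representative in `K` of the class of `x(P) - θ` modulo squares. -/
def Point.xSub (θ : K) : W.Point → K
  | .zero => 1
  | .some x _ _ => algebraMap F K x - θ

theorem Point.xSub_ne_zero (hθ : θ ∉ Set.range (algebraMap F K)) (P : W.Point) :
    P.xSub θ ≠ 0 := by
  rcases P with _ | ⟨x, y, h⟩
  · exact one_ne_zero
  · exact fun h0 => hθ ⟨x, sub_eq_zero.mp h0⟩

/-- A line evaluated at the `x`-coordinate of a `2`-torsion point `(θ, η)`: the polynomial whose
roots are the `x`-coordinates of its intersection points with the curve takes a square value. -/
theorem aeval_addPolynomial_of_two_torsion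
    (htor : 2 * η + algebraMap F K W.a₁ * θ + algebraMap F K W.a₃ = 0)
    (heq : η ^ 2 + algebraMap F K W.a₁ * θ * η + algebraMap F K W.a₃ * η =
      θ ^ 3 + algebraMap F K W.a₂ * θ ^ 2 + algebraMap F K W.a₄ * θ + algebraMap F K W.a₆)
    (x y ℓ : F) :
    aeval θ (W.addPolynomial x y ℓ) =
      (algebraMap F K ℓ * (θ - algebraMap F K x) + algebraMap F K y - η) ^ 2 := by
  rw [addPolynomial_eq, Cubic.toPoly]
  simp only [map_neg, map_add, map_mul, map_sub, map_pow, aeval_C, aeval_X, map_one, map_ofNat]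
  linear_combination heq +
    (algebraMap F K ℓ * (θ - algebraMap F K x) + algebraMap F K y - η) * htor

theorem Point.isSquare_xSub_mul_xSub_mul_xSub_add [DecidableEq F]
    (htor : 2 * η + algebraMap F K W.a₁ * θ + algebraMap F K W.a₃ = 0)
    (heq : η ^ 2 + algebraMap F K W.a₁ * θ * η + algebraMap F K W.a₃ * η =
      θ ^ 3 + algebraMap F K W.a₂ * θ ^ 2 + algebraMap F K W.a₄ * θ + algebraMap F K W.a₆)
    (P Q : W.Point) : IsSquare (P.xSub θ * Q.xSub θ * (P + Q).xSub θ) := by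
  rcases P with _ | ⟨x₁, y₁, h₁⟩
  · rw [← zero_def, zero_add]
    exact ⟨Q.xSub θ, by simp [xSub]⟩
  rcases Q with _ | ⟨x₂, y₂, h₂⟩
  · rw [← zero_def, add_zero]
    exact ⟨(some x₁ y₁ h₁).xSub θ, by simp [xSub]⟩
  by_cases hxy : x₁ = x₂ ∧ y₁ = W.negY x₂ y₂
  · rw [add_of_Y_eq hxy.1 hxy.2]
    exact ⟨algebraMap F K x₁ - θ, by simp [xSub, hxy.1]⟩
  · rw [add_some hxy]
    have key := aeval_addPolynomial_of_two_torsion htor heq x₁ y₁ (W.slope x₁ x₂ y₁ y₂)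
    rw [addPolynomial_slope h₁.1 h₂.1 hxy] at key
    simp only [map_neg, map_mul, map_sub, aeval_C, aeval_X] at key
    refine ⟨_, Eq.trans ?_ (key.trans (sq _))⟩
    simp only [xSub]
    ring

theorem Point.isSquare_prod_xSub [DecidableEq F] (hθ : θ ∉ Set.range (algebraMap F K))
    (htor : 2 * η + algebraMap F K W.a₁ * θ + algebraMap F K W.a₃ = 0)
    (heq : η ^ 2 + algebraMap F K W.a₁ * θ * η + algebraMap F K W.a₃ * η =
      θ ^ 3 + algebraMap F K W.a₂ * θ ^ 2 + algebraMap F K W.a₄ * θ + algebraMap F K W.a₆)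
    {ι : Type*} (P : ι → W.Point) (S : Finset ι) (Q : W.Point)
    (hS : ∑ i ∈ S, P i = (2 : ℤ) • Q) : IsSquare (∏ i ∈ S, (P i).xSub θ) := by
  classical
  have add_sq := isSquare_xSub_mul_xSub_mul_xSub_add htor heq
  have cancel : ∀ {a b : K}, a ≠ 0 → IsSquare a → IsSquare (a * b) → IsSquare b := by
    intro a b ha h h'
    simpa [ha] using h'.div h
  have chain : ∀ {a b c d : K}, b ≠ 0 → IsSquare (a * b * c) → IsSquare (b * d) →
      IsSquare (c * (a * d)) := by
    intro a b c d hb h h'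
    refine cancel (mul_self_ne_zero.mpr hb) ⟨b, rfl⟩ ?_
    rw [show b * b * (c * (a * d)) = a * b * c * (b * d) by ring]
    exact h.mul h'
  have sum_sq : ∀ S : Finset ι,
      IsSquare ((∑ i ∈ S, P i).xSub θ * ∏ i ∈ S, (P i).xSub θ) := by
    intro S
    induction S using Finset.induction_on with
    | empty => exact ⟨1, by simp [xSub, zero_def]⟩
    | insert i S hi ih =>
      rw [Finset.sum_insert hi, Finset.prod_insert hi]
      exact chain (xSub_ne_zero hθ _) (add_sq _ _) ih
  have double_sq : IsSquare ((∑ i ∈ S, P i).xSub θ) := by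
    rw [hS, two_zsmul]
    exact cancel (mul_self_ne_zero.mpr (xSub_ne_zero hθ Q)) ⟨_, rfl⟩ (add_sq Q Q)
  exact cancel (xSub_ne_zero hθ _) double_sq (sum_sq S)

end WeierstrassCurve.Affine

/-- A `p`-adic integer which is a square in `ℚ_[p]` is a square modulo `p`. -/
theorem PadicInt.isSquare_toZMod {p : ℕ} [Fact p.Prime] {z : ℤ_[p]}
    (hz : IsSquare (z : ℚ_[p])) : IsSquare (PadicInt.toZMod z) := by
  obtain ⟨w, hw⟩ := hz
  have hnorm : ‖w‖ ≤ 1 := by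
    have h : ‖w‖ * ‖w‖ ≤ 1 := by rw [← norm_mul, ← hw]; exact z.2
    nlinarith [norm_nonneg w]
  have hzw : z = ⟨w, hnorm⟩ * ⟨w, hnorm⟩ := Subtype.ext hw
  exact hzw ▸ ⟨_, map_mul _ _ _⟩

/-- Hensel's lemma for a simple root modulo `p` of an integral polynomial. -/
theorem PadicInt.exists_aeval_eq_zero_toZMod_eq {p : ℕ} [Fact p.Prime] (f : ℤ[X]) (r : ℤ)
    (hr : (p : ℤ) ∣ f.eval r) (hr' : ¬ (p : ℤ) ∣ f.derivative.eval r) :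
    ∃ θ : ℤ_[p], aeval θ f = 0 ∧ PadicInt.toZMod θ = r := by
  have aeval_int : ∀ g : ℤ[X], aeval (r : ℤ_[p]) g = ((g.eval r : ℤ) : ℤ_[p]) := fun g => by
    simpa using aeval_algebraMap_apply_eq_algebraMap_eval (A := ℤ_[p]) r g
  have hd : ‖aeval (r : ℤ_[p]) f.derivative‖ = 1 := by
    rw [aeval_int]
    exact le_antisymm (PadicInt.norm_le_one _)
      (not_lt.mp fun h => hr' ((PadicInt.norm_int_lt_one_iff_dvd _).mp h))
  obtain ⟨θ, hθ, hclose, -⟩ := hensels_lemma (F := f) (a := (r : ℤ_[p])) (by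
    rw [hd, one_pow, aeval_int]
    exact (PadicInt.norm_int_lt_one_iff_dvd _).mpr hr)
  refine ⟨θ, hθ, ?_⟩
  have hker : θ - r ∈ RingHom.ker (PadicInt.toZMod (p := p)) := by
    rw [PadicInt.ker_toZMod, IsLocalRing.mem_maximalIdeal, PadicInt.mem_nonunits]
    rwa [hd] at hclose
  simpa [sub_eq_zero] using hker

namespace RankNineCurve

/-- The curve `y² + y = x³ - 167419 x + 30261330`. -/
abbrev curve : WeierstrassCurve ℚ := ⟨0, 0, 1, -167419, 30261330⟩

/-- The `2`-division polynomial of the curve. -/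
noncomputable abbrev twoDivision : ℤ[X] := 4 * X ^ 3 - 669676 * X + 121045321

theorem twoDivision_ne_zero (x : ℚ) : 4 * x ^ 3 - 669676 * x + 121045321 ≠ 0 := by
  intro hx
  have hmonic : (X ^ 3 - 669676 * X + 242090642 : ℤ[X]).Monic := by monicity!
  obtain ⟨n, hn⟩ := isInteger_of_is_root_of_monic hmonic (r := 2 * x) (by
    simp only [map_add, map_sub, map_mul, map_pow, aeval_X, map_ofNat]
    linear_combination 2 * hx)
  have hn' : (n : ℚ) = 2 * x := by simpa using hn
  have hroot : n ^ 3 - 669676 * n + 242090642 = 0 := by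
    have h : (n : ℚ) ^ 3 - 669676 * n + 242090642 = 0 := by
      rw [hn']
      linear_combination 2 * hx
    exact_mod_cast h
  have hmod := congrArg (Int.cast : ℤ → ZMod 5) hroot
  push_cast at hmod
  revert hmod
  generalize (n : ZMod 5) = m
  revert m
  decide

theorem equation_iff (x y : ℚ) :
    curve.toAffine.Equation x y ↔ y ^ 2 + y = x ^ 3 - 167419 * x + 30261330 := by
  rw [WeierstrassCurve.Affine.equation_iff]
  simp [sub_eq_add_neg]

theorem discriminant : curve.Δ = -95276302704064331 := by
  norm_num [WeierstrassCurve.Δ, WeierstrassCurve.b₂, WeierstrassCurve.b₄, WeierstrassCurve.b₆,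
    WeierstrassCurve.b₈]

theorem eq_zero_of_two_smul_eq_zero (P : curve.toAffine.Point) (hP : (2 : ℤ) • P = 0) :
    P = 0 := by
  rw [two_zsmul, add_eq_zero_iff_eq_neg] at hP
  rcases P with _ | ⟨x, y, h⟩
  · rfl
  rw [WeierstrassCurve.Affine.Point.neg_some] at hP
  have hy : y = -y - 1 := by
    simpa [WeierstrassCurve.Affine.negY] using (WeierstrassCurve.Affine.Point.some.inj hP).2
  exact absurd (by linear_combination (2 * y + 1) * hy - 4 * (equation_iff x y).mp h.1)
    (twoDivision_ne_zero x)

/-- If a subsum of integral points is divisible by `2`, then the product of the `x - r` over the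
subset is a square modulo `p`, for every simple root `r` modulo `p` of the `2`-division
polynomial. -/
theorem isSquare_prod_sub {ι : Type*} {x y : ι → ℤ}
    (h : ∀ i, curve.toAffine.Nonsingular (x i) (y i)) (p : ℕ) [Fact p.Prime] (r : ℤ)
    (hr : (p : ℤ) ∣ 4 * r ^ 3 - 669676 * r + 121045321)
    (hr' : ¬ (p : ℤ) ∣ 12 * r ^ 2 - 669676) (S : Finset ι) (Q : curve.toAffine.Point)
    (hS : ∑ i ∈ S, (.some (x i : ℚ) (y i : ℚ) (h i) : curve.toAffine.Point) = (2 : ℤ) • Q) :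
    IsSquare (∏ i ∈ S, ((x i - r : ℤ) : ZMod p)) := by
  obtain ⟨θ, hθ, hθr⟩ := PadicInt.exists_aeval_eq_zero_toZMod_eq twoDivision r
    (by simpa using hr) (by
      convert hr' using 2
      simp
      ring)
  have hroot : 4 * (θ : ℚ_[p]) ^ 3 - 669676 * θ + 121045321 = 0 := by
    have h0 : 4 * θ ^ 3 - 669676 * θ + 121045321 = 0 := by
      simpa only [map_add, map_sub, map_mul, map_pow, aeval_X, map_ofNat] using hθ
    exact_mod_cast congrArg ((↑) : ℤ_[p] → ℚ_[p]) h0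
  have hrange : (θ : ℚ_[p]) ∉ Set.range (algebraMap ℚ ℚ_[p]) := by
    rintro ⟨q, hq⟩
    rw [← hq, eq_ratCast] at hroot
    exact twoDivision_ne_zero q (by exact_mod_cast hroot)
  have hsq := WeierstrassCurve.Affine.Point.isSquare_prod_xSub (η := -1 / 2) hrange
    (by norm_num) (by
      simp only [map_zero, map_one, map_neg, map_ofNat]
      linear_combination -hroot / 4) _ S Q hS
  have hcoe : ∏ i ∈ S, (WeierstrassCurve.Affine.Point.some _ _ (h i)).xSub (θ : ℚ_[p]) =
      ((∏ i ∈ S, (x i - θ) : ℤ_[p]) : ℚ_[p]) := by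
    refine Eq.trans ?_ (map_prod PadicInt.Coe.ringHom _ S).symm
    exact Finset.prod_congr rfl fun i _ => by
      rw [map_sub, map_intCast]
      simp only [WeierstrassCurve.Affine.Point.xSub, map_intCast]
      rfl
  rw [hcoe] at hsq
  simpa [map_prod, hθr] using PadicInt.isSquare_toZMod hsq

/-- A prime at which exactly one of the `x - r` is a nonresidue excludes the corresponding point
from every subsum that is divisible by `2`. -/
theorem notMem_of_legendreSym {ι : Type*} [DecidableEq ι] {x y : ι → ℤ}
    (h : ∀ i, curve.toAffine.Nonsingular (x i) (y i)) (p : ℕ) [Fact p.Prime] (r : ℤ)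
    (hr : (p : ℤ) ∣ 4 * r ^ 3 - 669676 * r + 121045321)
    (hr' : ¬ (p : ℤ) ∣ 12 * r ^ 2 - 669676) {j : ι}
    (hleg : ∀ i, legendreSym p (x i - r) = if i = j then -1 else 1)
    (S : Finset ι) (Q : curve.toAffine.Point)
    (hS : ∑ i ∈ S, (.some (x i : ℚ) (y i : ℚ) (h i) : curve.toAffine.Point) = (2 : ℤ) • Q) :
    j ∉ S := by
  intro hj
  have hchar : quadraticChar (ZMod p) (∏ i ∈ S, ((x i - r : ℤ) : ZMod p)) = -1 := by
    rw [map_prod]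
    change ∏ i ∈ S, legendreSym p (x i - r) = -1
    simp [hleg, hj]
  exact quadraticChar_neg_one_iff_not_isSquare.mp hchar (isSquare_prod_sub h p r hr hr' S Q hS)

/-- The `x`-coordinates of nine independent integral points. -/
def xCoord : Fin 9 → ℤ := ![605, -347, 711, 100907, 313, 10792, 6677, 337, -285]

/-- The `y`-coordinates of nine independent integral points. -/
def yCoord : Fin 9 → ℤ :=
  ![12264, 6824, 16451, 32053715, 2919, 1120329, 544599, 3480, 7404]

theorem nonsingular_coord (i : Fin 9) : curve.toAffine.Nonsingular (xCoord i) (yCoord i) := by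
  refine (WeierstrassCurve.Affine.equation_iff_nonsingular_of_Δ_ne_zero
    (by rw [discriminant]; norm_num)).mp ((equation_iff _ _).mpr ?_)
  fin_cases i <;> norm_num [xCoord, yCoord]

/-- Primes `p` such that exactly one of the nine points, the one with the same index, has a
nonresidue `x - r`, where `r` is the root `residueRoot` of the `2`-division polynomial. -/
def descentPrime : Fin 9 → ℕ := ![1301, 163, 571, 257, 677, 37, 277, 79, 1933]

/-- Roots of the `2`-division polynomial modulo the primes `descentPrime`. -/
def residueRoot : Fin 9 → ℤ := ![111, 135, 141, 21, 427, 20, 136, 30, 1332]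

theorem prime_descentPrime (j : Fin 9) : (descentPrime j).Prime := by
  fin_cases j <;> norm_num [descentPrime]

instance (j : Fin 9) : Fact (descentPrime j).Prime := ⟨prime_descentPrime j⟩

theorem legendreSym_coord (i j : Fin 9) :
    legendreSym (descentPrime j) (xCoord i - residueRoot j) = if i = j then -1 else 1 := by
  rw [jacobiSym.legendreSym.to_jacobiSym]
  fin_cases j <;> fin_cases i <;> norm_num [descentPrime, xCoord, residueRoot]

theorem linearIndependent_points :
    LinearIndependent ℤ fun i : Fin 9 =>
      (.some (xCoord i : ℚ) (yCoord i : ℚ) (nonsingular_coord i) : curve.toAffine.Point) := by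
  refine linearIndependent_int_of_sum_ne_two_smul eq_zero_of_two_smul_eq_zero fun S Q hS =>
    Finset.eq_empty_of_forall_notMem fun j => ?_
  refine notMem_of_legendreSym nonsingular_coord (descentPrime j) (residueRoot j) ?_ ?_
    (legendreSym_coord · j) S Q hS
  · fin_cases j <;> norm_num [descentPrime, residueRoot]
  · fin_cases j <;> norm_num [descentPrime, residueRoot]

end RankNineCurve


/-- The elliptic curve `[0, 0, 1, -167419, 30261330]` has discriminant of absolute value `95276302704064331`,
and its group of rational points contains `9` points that are linearly independent
over `ℤ` (so its Mordell–Weil rank is at least `9`). -/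
theorem rank9_low_discriminant_curve (W : WeierstrassCurve ℚ)
    (hW : W = ⟨0, 0, 1, -167419, 30261330⟩) :
    |W.Δ| = 95276302704064331 ∧
      ∃ P : Fin 9 → W.toAffine.Point, LinearIndependent ℤ P := by
  subst hW
  exact ⟨by rw [RankNineCurve.discriminant]; norm_num, _, RankNineCurve.linearIndependent_points⟩
end
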